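/- arXiv:1701.05591 — 4 statements merged into one kernel-verified Lean document; each statement's English description precedes it below -/
import Mathlib

section
/- Let n be an odd integer with n > 3, and let c₁ be the minimum of f(n,p) taken over all primes p with 3 ≤ p ≤ ⌈√n⌉. Then c₁ is the smallest odd composite number strictly exceeding n; that is, c₁ is odd, composite, c₁ > n, and every odd composite number exceeding n is greater than or equal to c₁. -/
/-- `f n x = n + 2x - ((n - x) mod 2x)`, computed in the integers, where
`%` is the Euclidean remainder (nonnegative for a positive modulus). -/
def f (n x : ℤ) : ℤ := n + 2 * x - (n - x) % (2 * x)

/-- A composite number: an integer greater than 1 that is not prime. -/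
def IsComposite (m : ℤ) : Prop := 1 < m ∧ ¬ Prime m

theorem f_eq_mul (n x : ℤ) : f n x = x * (2 * ((n - x) / (2 * x)) + 3) := by
  unfold f
  linear_combination -(Int.emod_add_mul_ediv (n - x) (2 * x))

theorem lt_f {x : ℤ} (n : ℤ) (hx : 0 < x) : n < f n x := by
  have := Int.emod_lt_of_pos (n - x) (show 0 < 2 * x by omega)
  unfold f
  omega

theorem f_le_add {x : ℤ} (n : ℤ) (hx : 0 < x) : f n x ≤ n + 2 * x := by
  have := Int.emod_nonneg (n - x) (show 2 * x ≠ 0 by omega)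
  unfold f
  omega

theorem odd_f {x : ℤ} (n : ℤ) (hx : Odd x) : Odd (f n x) := by
  rw [f_eq_mul]
  exact hx.mul ⟨(n - x) / (2 * x) + 1, by ring⟩

theorem not_prime_f {n x : ℤ} (hx : 1 < x) (hxn : x ≤ n) : ¬ Prime (f n x) := by
  intro hp
  have hlt := lt_f n (show 0 < x by omega)
  have heq := f_eq_mul n x
  rcases hp.irreducible.isUnit_or_isUnit heq with h | h
  · rcases Int.isUnit_iff.1 h with h | h <;> omega
  · rcases Int.isUnit_iff.1 h with h | h <;> rw [heq, h] at hlt <;> omega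

/-- `f n x` is at most every odd multiple of `x` exceeding `n`. -/
theorem f_le_of_dvd {n x m : ℤ} (hx : 0 < x) (hm : Odd m) (hxm : x ∣ m) (hnm : n < m) :
    f n x ≤ m := by
  obtain ⟨y, rfl⟩ := hxm
  obtain ⟨k, rfl⟩ := (Int.odd_mul.1 hm).2
  by_contra! h
  have hle := f_le_add n hx
  rw [f_eq_mul] at h hle
  have := lt_of_mul_lt_mul_left h hx.le
  have : x * (2 * k + 1) ≤ x * (2 * ((n - x) / (2 * x)) + 1) :=
    mul_le_mul_of_nonneg_left (by omega) hx.le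
  linarith

theorem Prime.odd_of_three_le {p : ℤ} (hp : Prime p) (h : 3 ≤ p) : Odd p := by
  have hp' := Int.prime_iff_natAbs_prime.1 hp
  exact Int.natAbs_odd.1 (hp'.odd_of_ne_two (by omega))

theorem IsComposite.exists_prime_dvd_sq_le {m : ℤ} (hm : IsComposite m) (hodd : Odd m) :
    ∃ p : ℤ, Prime p ∧ 3 ≤ p ∧ p ∣ m ∧ p ^ 2 ≤ m := by
  obtain ⟨h1, hnp⟩ := hm
  lift m to ℕ using by omega
  rw [← Nat.prime_iff_prime_int] at hnp
  have hp : m.minFac.Prime := Nat.minFac_prime (by omega)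
  have hpm : (m.minFac : ℤ) ∣ m := Int.natCast_dvd_natCast.2 m.minFac_dvd
  refine ⟨m.minFac, Nat.prime_iff_prime_int.1 hp, ?_, hpm,
    by exact_mod_cast Nat.minFac_sq_le_self (by omega) hnp⟩
  have h2 := hp.two_le
  have : Odd (m.minFac : ℤ) := Odd.of_dvd_nat (by exact_mod_cast hodd) m.minFac_dvd |>.natCast
  obtain ⟨k, hk⟩ := this
  omega

/-- For odd `n > 3`, if `c₁` is the minimum of `f n p` over primes
`p` with `3 ≤ p ≤ ⌈√n⌉`, then `c₁` is the smallest odd composite exceeding `n`. -/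
theorem smallest_odd_composite_exceeding (n : ℤ) (hnodd : Odd n) (hn : 3 < n)
    (c₁ : ℤ)
    (hc : IsLeast {m : ℤ | ∃ p : ℤ, Prime p ∧ 3 ≤ p ∧ p ≤ ⌈Real.sqrt (n : ℝ)⌉ ∧
        m = f n p} c₁) :
    Odd c₁ ∧ IsComposite c₁ ∧ n < c₁ ∧
      ∀ m : ℤ, Odd m → IsComposite m → n < m → c₁ ≤ m := by
  obtain ⟨⟨p, hp, h3, hps, rfl⟩, hmin⟩ := hc
  have hn1 : (1 : ℝ) ≤ n := by exact_mod_cast (show (1 : ℤ) ≤ n by omega)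
  have hsn : ⌈Real.sqrt (n : ℝ)⌉ ≤ n :=
    Int.ceil_le.2 (Real.sqrt_le_iff.2 ⟨by linarith, by nlinarith⟩)
  have hlt := lt_f n (show 0 < p by omega)
  refine ⟨odd_f n (hp.odd_of_three_le h3),
    ⟨by omega, not_prime_f (by omega) (hps.trans hsn)⟩, hlt, fun m hm hcomp hnm => ?_⟩
  obtain ⟨q, hq, hq3, hqm, hqsq⟩ := hcomp.exists_prime_dvd_sq_le hm
  by_cases hqs : q ≤ ⌈Real.sqrt (n : ℝ)⌉
  · exact (hmin ⟨q, hq, hq3, hqs, rfl⟩).trans (f_le_of_dvd (by omega) hm hqm hnm)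
  · have hns : n ≤ ⌈Real.sqrt (n : ℝ)⌉ ^ 2 := by
      have h := (Real.sqrt_le_iff.1 (Int.le_ceil (Real.sqrt (n : ℝ)))).2
      exact_mod_cast h
    have h3min := hmin ⟨3, Int.prime_three, le_rfl, h3.trans hps, rfl⟩
    have h3le := f_le_add n (show (0 : ℤ) < 3 by norm_num)
    nlinarith
end

section
/- Let n be an odd integer with n > 3, and let c₁ be the minimum of f(n,p) taken over all primes p with 3 ≤ p ≤ ⌈√n⌉ (equivalently, the smallest odd composite exceeding n). Then n + 2 is prime if and only if c₁ − n = 4 or c₁ − n = 6. -/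
/-- For `x > 0`, `f n x` is an odd multiple of `x` in `(n, n + 2 * x]`. -/
theorem exists_f_eq (n x : ℤ) (hx : 0 < x) :
    ∃ k : ℤ, f n x = x * (2 * k + 1) ∧ n < f n x ∧ f n x ≤ n + 2 * x := by
  have h := Int.emod_add_mul_ediv (n - x) (2 * x)
  have h0 := Int.emod_nonneg (n - x) (b := 2 * x) (by omega)
  have h1 := Int.emod_lt_of_pos (n - x) (b := 2 * x) (by omega)
  refine ⟨(n - x) / (2 * x) + 1, ?_, ?_, ?_⟩ <;> unfold f
  · linear_combination -h
  · omega
  · omega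

/-- If the odd number `n + 2` is a multiple of `p > 0`, then it is `f n p`. -/
theorem f_eq_add_two {n p : ℤ} (hp : 0 < p) (hodd : Odd (n + 2)) (hdvd : p ∣ n + 2) :
    f n p = n + 2 := by
  obtain ⟨j, hj⟩ := hdvd
  rw [hj] at hodd
  obtain ⟨i, rfl⟩ := (Int.odd_mul.mp hodd).2
  have hmod : (n - p) % (2 * p) = 2 * p - 2 := by
    rw [show n - p = (2 * p - 2) + 2 * p * (i - 1) by linear_combination hj,
      Int.add_mul_emod_self_left]
    exact Int.emod_eq_of_lt (by omega) (by omega)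
  rw [f, hmod]
  ring

/-- An odd `m > 1` that is not prime has an odd prime divisor whose square is at most `m`. -/
theorem exists_odd_prime_dvd_sq_le {m : ℤ} (hm : 1 < m) (hodd : Odd m) (hnp : ¬ Prime m) :
    ∃ p : ℤ, Prime p ∧ 3 ≤ p ∧ p ∣ m ∧ p ^ 2 ≤ m := by
  lift m to ℕ using by omega
  rw [← Nat.prime_iff_prime_int] at hnp
  have hpr : m.minFac.Prime := Nat.minFac_prime (by omega)
  have hdvd := Nat.minFac_dvd m
  refine ⟨m.minFac, Nat.prime_iff_prime_int.mp hpr, ?_, by exact_mod_cast hdvd,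
    by exact_mod_cast Nat.minFac_sq_le_self (by omega) hnp⟩
  have h2 := hpr.two_le
  have hne : m.minFac ≠ 2 := fun h => by
    rw [h] at hdvd
    obtain ⟨k, hk⟩ := hodd
    omega
  omega

theorem le_ceil_sqrt_of_sub_one_sq_lt {n p : ℤ} (h : (p - 1) ^ 2 < n) :
    p ≤ ⌈Real.sqrt (n : ℝ)⌉ := by
  have hlt : ((p - 1 : ℤ) : ℝ) < Real.sqrt n :=
    Real.lt_sqrt_of_sq_lt (by exact_mod_cast h)
  have := Int.lt_ceil.mpr hlt
  omega

/-- For odd `n > 3`, with `c₁` the minimum of `f n p` over primes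
`p` with `3 ≤ p ≤ ⌈√n⌉`, the number `n + 2` is prime iff `c₁ - n = 4` or
`c₁ - n = 6`. -/
theorem primality_test_gap (n : ℤ) (hnodd : Odd n) (hn : 3 < n) (c₁ : ℤ)
    (hc : IsLeast {m : ℤ | ∃ p : ℤ, Prime p ∧ 3 ≤ p ∧ p ≤ ⌈Real.sqrt (n : ℝ)⌉ ∧
        m = f n p} c₁) :
    Prime (n + 2) ↔ (c₁ - n = 4 ∨ c₁ - n = 6) := by
  have hn2 : Odd (n + 2) := hnodd.add_even even_two
  have hn5 : 5 ≤ n := by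
    obtain ⟨k, rfl⟩ := hnodd
    omega
  obtain ⟨⟨p, hp, hp3, hpc, rfl⟩, hmin⟩ := hc
  obtain ⟨k, hk, hlt, -⟩ := exists_f_eq n p (by omega)
  constructor
  · intro hprime
    have h3c : (3 : ℤ) ≤ ⌈Real.sqrt (n : ℝ)⌉ :=
      le_ceil_sqrt_of_sub_one_sq_lt (by omega)
    have hle : f n p ≤ f n 3 := hmin ⟨3, Int.prime_three, le_rfl, h3c, rfl⟩
    obtain ⟨-, -, -, h3⟩ := exists_f_eq n 3 (by norm_num)
    have hceil : ⌈Real.sqrt (n : ℝ)⌉ ≤ n := by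
      rw [Int.ceil_le, Real.sqrt_le_left (by exact_mod_cast (by omega : 0 ≤ n))]
      exact_mod_cast (by nlinarith : n ≤ n ^ 2)
    have hne : f n p ≠ n + 2 := fun h => by
      have hassoc := (hp.dvd_prime_iff_associated hprime).mp ⟨_, h.symm.trans hk⟩
      rcases Int.associated_iff.mp hassoc with h | h <;> omega
    have hoddf : Odd (f n p) := by
      rw [hk]
      refine Int.odd_mul.mpr ⟨?_, k, rfl⟩
      by_contra hev
      have hdvd := (Int.not_odd_iff_even.mp hev).two_dvd
      have hassoc := (Int.prime_two.dvd_prime_iff_associated hp).mp hdvd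
      rcases Int.associated_iff.mp hassoc with h | h <;> omega
    obtain ⟨a, ha⟩ := hnodd
    obtain ⟨b, hb⟩ := hoddf
    omega
  · intro hgap
    by_contra hnp
    obtain ⟨q, hq, hq3, hqd, hqs⟩ := exists_odd_prime_dvd_sq_le (by omega) hn2 hnp
    have hle : f n p ≤ f n q :=
      hmin ⟨q, hq, hq3, le_ceil_sqrt_of_sub_one_sq_lt (by nlinarith), rfl⟩
    rw [f_eq_add_two (by omega) hn2 hqd] at hle
    omega
end

section
/- Let n be an odd integer with n ≥ 3 and let x be a positive odd integer. Then x divides n if and only if f(n − 2, x) = n. -/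
/-- For an odd integer `n ≥ 3` and a positive odd integer `x`,
`x` divides `n` iff `f (n - 2) x = n`. -/
theorem factor_iff_f_eq (n x : ℤ) (hnodd : Odd n) (hn : 3 ≤ n)
    (hx : 0 < x) (hxodd : Odd x) :
    x ∣ n ↔ f (n - 2) x = n := by
  have key : f (n - 2) x = n ↔ (n - 2 - x) % (2 * x) = 2 * x - 2 := by
    unfold f
    constructor <;> intro h <;> linarith
  rw [key]
  constructor
  · rintro ⟨k, rfl⟩
    obtain ⟨j, rfl⟩ := (Int.odd_mul.mp hnodd).2
    rw [show x * (2 * j + 1) - 2 - x = 2 * x - 2 + 2 * x * (j - 1) by ring,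
      Int.add_mul_emod_self_left]
    exact Int.emod_eq_of_lt (by linarith) (by linarith)
  · intro h
    have hdiv := Int.emod_add_mul_ediv (n - 2 - x) (2 * x)
    rw [h] at hdiv
    exact ⟨3 + 2 * ((n - 2 - x) / (2 * x)), by linarith⟩
end

section
/- Let n be an odd integer with n ≥ 3. Then n is prime if and only if the only positive odd integers x satisfying f(n − 2, x) = n are x = 1 and x = n; that is, n is prime if and only if the set {x : x is a positive odd integer and f(n − 2, x) = n} equals {1, n}. -/
theorem f_sub_two_eq_iff_dvd {n x : ℤ} (hx : 0 < x) :
    f (n - 2) x = n ↔ 2 * x ∣ n - x := by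
  have hf : f (n - 2) x = n ↔ (n - 2 - x) % (2 * x) = 2 * x - 2 := by
    unfold f
    constructor <;> intro h <;> linarith
  have hmod : (2 * x - 2) % (2 * x) = 2 * x - 2 :=
    Int.emod_eq_of_lt (by linarith) (by linarith)
  calc f (n - 2) x = n ↔ (n - 2 - x) % (2 * x) = (2 * x - 2) % (2 * x) := by rw [hf, hmod]
    _ ↔ 2 * x ∣ (n - x) - 2 * x := by
      rw [Int.emod_eq_emod_iff_emod_sub_eq_zero, ← Int.dvd_iff_emod_eq_zero]
      ring_nf
    _ ↔ 2 * x ∣ n - x := dvd_sub_self_right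

theorem odd_and_two_mul_dvd_sub_iff_dvd {n x : ℤ} (hn : Odd n) :
    Odd x ∧ 2 * x ∣ n - x ↔ x ∣ n := by
  constructor
  · rintro ⟨-, k, hk⟩
    exact ⟨2 * k + 1, by linarith⟩
  · rintro ⟨k, rfl⟩
    obtain ⟨hx, m, rfl⟩ := Int.odd_mul.mp hn
    exact ⟨hx, m, by ring⟩

theorem Int.prime_iff_forall_pos_dvd {n : ℤ} (hn : 2 ≤ n) :
    Prime n ↔ ∀ x : ℤ, 0 < x → x ∣ n → x = 1 ∨ x = n := by
  lift n to ℕ using by linarith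
  rw [← Nat.prime_iff_prime_int, Nat.prime_def]
  constructor
  · rintro ⟨-, h⟩ x hx hxn
    lift x to ℕ using hx.le
    exact_mod_cast h x (by exact_mod_cast hxn)
  · refine fun h => ⟨by exact_mod_cast hn, fun m hm => ?_⟩
    have hm0 : 0 < m := Nat.pos_of_dvd_of_pos hm (by omega)
    exact_mod_cast h m (by exact_mod_cast hm0) (by exact_mod_cast hm)

/-- An odd integer `n ≥ 3` is prime iff the only positive odd
integers `x` with `f (n - 2) x = n` are `1` and `n`. -/
theorem prime_iff_f_solutions (n : ℤ) (hnodd : Odd n) (hn : 3 ≤ n) :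
    Prime n ↔
      {x : ℤ | 0 < x ∧ Odd x ∧ f (n - 2) x = n} = {1, n} := by
  have hset : {x : ℤ | 0 < x ∧ Odd x ∧ f (n - 2) x = n} = {x : ℤ | 0 < x ∧ x ∣ n} := by
    ext x
    refine and_congr_right fun hx => ?_
    rw [f_sub_two_eq_iff_dvd hx, odd_and_two_mul_dvd_sub_iff_dvd hnodd]
  rw [hset, Int.prime_iff_forall_pos_dvd (by linarith)]
  constructor
  · intro h
    ext x
    constructor
    · rintro ⟨hx, hxn⟩
      exact h x hx hxn
    · rintro (rfl | rfl)
      · exact ⟨one_pos, one_dvd n⟩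
      · exact ⟨by linarith, dvd_rfl⟩
  · intro h x hx hxn
    exact h.subset ⟨hx, hxn⟩
end
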